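/- Suppose Assumption 1 holds, the true probbase satisfies q_{jk} ∈ (0,1) for all j,k, and P(A_{−ℓ} = α_{−ℓ}) > 0 for every block index ℓ and every answer vector α. Suppose the VA algorithm V satisfies, for every block index ℓ and every candidate probbase q̃ ∈ (0,1)^{r×s}: [V(α_{−ℓ}, q̃)_j = P(D = j | A_{−ℓ} = α_{−ℓ}) for every answer vector α and every cause j] holds if and only if [q̃_{jk} = q_{jk} for all j and all k ∉ B_ℓ]. Suppose further there is a block index ι with |B_ι| ≥ r such that the candidate probbase q̂ ∈ (0,1)^{r×s} satisfies q̂_{jk} = q_{jk} for all j and all k ∈ B_ι, and the r × |B_ι| matrix (q_{jk})_{j ∈ {1,…,r}, k ∈ B_ι} has rank r. Then if q̂ ≠ q, I^V(q̂) > I^V(q). -/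

import Mathlib

open Classical
noncomputable section

/-- An answer to a verbal autopsy question: `some true` = "1" (yes),
`some false` = "0" (no), `none` = "NA" (missing). -/
abbrev Ans := Option Bool

/-- Probability of an event `E` under a probability mass function `P`
on a finite sample space `Ω`. -/
def pr {Ω : Type*} [Fintype Ω] (P : Ω → ℝ) (E : Ω → Prop) : ℝ :=
  ∑ ω, if E ω then P ω else 0

/-- Conditional probability `P(E | F) = P(E ∧ F) / P(F)`. -/
def cpr {Ω : Type*} [Fintype Ω] (P : Ω → ℝ) (E F : Ω → Prop) : ℝ :=
  pr P (fun ω => E ω ∧ F ω) / pr P F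

/-- The answer vector `α` with every entry in block `ℓ` replaced by `NA`;
this is `α₋ℓ`. -/
def mask {s b : ℕ} (B : Fin s → Fin b) (ℓ : Fin b) (α : Fin s → Ans) : Fin s → Ans :=
  fun k => if B k = ℓ then none else α k

/-- The event `{A₋ℓ = α₋ℓ}`: all answers outside block `ℓ` agree with `α`. -/
def maskEv {r s b : ℕ} (B : Fin s → Fin b) (ℓ : Fin b) (α : Fin s → Ans) :
    (Fin s → Ans) × Fin r → Prop :=
  fun ω => ∀ m, B m ≠ ℓ → ω.1 m = α m

/-- `F_k(pih, qh) = Σ_j pih_j qh_{jk}`. -/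
def Fk {r s : ℕ} (k : Fin s) (pih : Fin r → ℝ) (qh : Fin r → Fin s → ℝ) : ℝ :=
  ∑ j, pih j * qh j k

/-- Cross-entropy loss `L(ŷ, y) = -(y log ŷ + (1-y) log(1-ŷ))`. -/
def loss (yh y : ℝ) : ℝ := -(y * Real.log yh + (1 - y) * Real.log (1 - yh))

/-- A candidate probbase has all entries in the open interval (0,1). -/
def isProbbase {r s : ℕ} (qh : Fin r → Fin s → ℝ) : Prop :=
  ∀ j k, qh j k ∈ Set.Ioo (0 : ℝ) 1

/-- A VA algorithm maps an answer vector and a candidate probbase to a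
probability vector over causes of death (an element of the simplex Δ_r). -/
def isVA {r s : ℕ} (V : (Fin s → Ans) → (Fin r → Fin s → ℝ) → Fin r → ℝ) : Prop :=
  ∀ (a : Fin s → Ans) (qh : Fin r → Fin s → ℝ), isProbbase qh →
    (∀ j, 0 ≤ V a qh j) ∧ (∑ j, V a qh j) = 1

/-- The true probbase: `q_{jk} = P(A_k = 1 | D = j)`. -/
def trueQ {r s : ℕ} (P : (Fin s → Ans) × Fin r → ℝ) : Fin r → Fin s → ℝ :=
  fun j k => cpr P (fun ω => ω.1 k = some true) (fun ω => ω.2 = j)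

/-- Assumption 1 (blockwise conditional independence): the blocks of answers
are mutually conditionally independent given the cause of death `D`. -/
def Assump1 {r s b : ℕ} (P : (Fin s → Ans) × Fin r → ℝ) (B : Fin s → Fin b) : Prop :=
  ∀ (j : Fin r) (α : Fin s → Ans),
    cpr P (fun ω => ω.1 = α) (fun ω => ω.2 = j)
      = ∏ ℓ : Fin b, cpr P (fun ω => ∀ m, B m = ℓ → ω.1 m = α m) (fun ω => ω.2 = j)

/-- Imputation accuracy `I^V(qh) = E[L(F_K(V(A₋B(K), qh), qh), 1{A_K = 1})]`,
where `K` is uniform on questions and independent of `A`. -/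
def impAcc {r s b : ℕ} (P : (Fin s → Ans) × Fin r → ℝ) (B : Fin s → Fin b)
    (V : (Fin s → Ans) → (Fin r → Fin s → ℝ) → Fin r → ℝ)
    (qh : Fin r → Fin s → ℝ) : ℝ :=
  (1 / (s : ℝ)) * ∑ k : Fin s, ∑ α : Fin s → Ans,
    pr P (fun ω => ω.1 = α) *
      loss (Fk k (V (mask B (B k) α) qh) qh) (if α k = some true then 1 else 0)

/-- Empirical imputation accuracy `I_𝒜(qh)` over a dataset of `n` answer vectors. -/
def impAccEmp {r s b : ℕ} (n : ℕ) (B : Fin s → Fin b)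
    (V : (Fin s → Ans) → (Fin r → Fin s → ℝ) → Fin r → ℝ)
    (qh : Fin r → Fin s → ℝ) (a : Fin n → Fin s → Ans) : ℝ :=
  (1 / ((n : ℝ) * (s : ℝ))) * ∑ i : Fin n, ∑ k : Fin s,
    loss (Fk k (V (mask B (B k) (a i)) qh) qh) (if a i k = some true then 1 else 0)

/-- `i_α(qh) = Σ_k L(F_k(V(α₋B(k), qh), qh), 1{α_k = 1})`. -/
def iAlpha {r s b : ℕ} (B : Fin s → Fin b)
    (V : (Fin s → Ans) → (Fin r → Fin s → ℝ) → Fin r → ℝ)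
    (qh : Fin r → Fin s → ℝ) (α : Fin s → Ans) : ℝ :=
  ∑ k : Fin s, loss (Fk k (V (mask B (B k) α) qh) qh) (if α k = some true then 1 else 0)


/-! ### Helper lemmas -/

lemma kl_aux (g h : ℝ) (hg : g ∈ Set.Ioo (0:ℝ) 1) (hh : h ∈ Set.Ioo (0:ℝ) 1) :
    0 ≤ loss h g - loss g g ∧ (g ≠ h → 0 < loss h g - loss g g) := by
  obtain ⟨g0, g1⟩ := hg
  obtain ⟨h0, h1⟩ := hh
  have key : ∀ x y : ℝ, 0 < x → 0 < y →
      x * (Real.log y - Real.log x) ≤ y - x ∧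
      (x ≠ y → x * (Real.log y - Real.log x) < y - x) := by
    intro x y hx hy
    have e : x * (y / x - 1) = y - x := by field_simp
    rw [← Real.log_div hy.ne' hx.ne', ← e]
    constructor
    · exact mul_le_mul_of_nonneg_left (Real.log_le_sub_one_of_pos (by positivity)) hx.le
    · intro hne
      refine mul_lt_mul_of_pos_left (Real.log_lt_sub_one_of_pos (by positivity) ?_) hx
      intro h
      rw [div_eq_one_iff_eq hx.ne'] at h
      exact hne h.symm
  have k1 := key g h g0 h0
  have k2 := key (1 - g) (1 - h) (by linarith) (by linarith)
  unfold loss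
  constructor
  · nlinarith [k1.1, k2.1]
  · intro hne
    nlinarith [k1.2 hne, k2.1]

lemma fiber_aux {X Y : Type*} [Fintype X] [Fintype Y] [DecidableEq Y] (m : X → Y) (p y g φ : X → ℝ)
    (hg : ∀ a b, m a = m b → g a = g b) (hφ : ∀ a b, m a = m b → φ a = φ b)
    (hcal : ∀ a, (∑ b, if m b = m a then p b * y b else 0)
      = g a * ∑ b, if m b = m a then p b else 0) :
    ∑ a, p a * y a * φ a = ∑ a, p a * g a * φ a := by
  rw [← Finset.sum_fiberwise Finset.univ m, ← Finset.sum_fiberwise Finset.univ m]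
  refine Finset.sum_congr rfl fun z _ => ?_
  by_cases hz : ∃ a, m a = z
  · obtain ⟨a, rfl⟩ := hz
    have h1 : ∀ b ∈ Finset.univ.filter (fun b => m b = m a),
        p b * y b * φ b = p b * y b * φ a := by
      intro b hb
      rw [hφ b a (Finset.mem_filter.1 hb).2]
    have h2 : ∀ b ∈ Finset.univ.filter (fun b => m b = m a),
        p b * g b * φ b = (p b) * (g a * φ a) := by
      intro b hb
      rw [hφ b a (Finset.mem_filter.1 hb).2, hg b a (Finset.mem_filter.1 hb).2]; ring
    rw [Finset.sum_congr rfl h1, Finset.sum_congr rfl h2, ← Finset.sum_mul, ← Finset.sum_mul,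
      Finset.sum_filter, Finset.sum_filter, hcal a]
    ring
  · have : Finset.univ.filter (fun b => m b = z) = ∅ := by
      ext b; simp; intro h; exact hz ⟨b, h⟩
    simp [this]

lemma gibbs_aux {X Y : Type*} [Fintype X] [Fintype Y] [DecidableEq Y] (m : X → Y) (p y g h : X → ℝ)
    (hp : ∀ a, 0 ≤ p a)
    (hg : ∀ a b, m a = m b → g a = g b) (hh : ∀ a b, m a = m b → h a = h b)
    (hg1 : ∀ a, g a ∈ Set.Ioo (0:ℝ) 1) (hh1 : ∀ a, h a ∈ Set.Ioo (0:ℝ) 1)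
    (hcal : ∀ a, (∑ b, if m b = m a then p b * y b else 0)
      = g a * ∑ b, if m b = m a then p b else 0)
    (hpos : ∀ a, 0 < ∑ b, if m b = m a then p b else 0) :
    (∑ a, p a * loss (g a) (y a) ≤ ∑ a, p a * loss (h a) (y a)) ∧
    ((∃ a, g a ≠ h a) → ∑ a, p a * loss (g a) (y a) < ∑ a, p a * loss (h a) (y a)) := by
  have hrep : ∀ h : X → ℝ, (∀ a b, m a = m b → h a = h b) →
      ∑ a, p a * loss (h a) (y a) = ∑ a, p a * loss (h a) (g a) := by
    intro h hh
    have := fiber_aux m p y g (fun a => Real.log (1 - h a) - Real.log (h a)) hg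
      (fun a b hab => by simp only [hh a b hab]) hcal
    have e : ∀ w : X → ℝ, ∑ a, p a * loss (h a) (w a) =
        ∑ a, p a * w a * (Real.log (1 - h a) - Real.log (h a))
          - ∑ a, p a * Real.log (1 - h a) := by
      intro w
      rw [← Finset.sum_sub_distrib]
      refine Finset.sum_congr rfl fun a _ => ?_
      unfold loss; ring
    rw [e, e, this]
  rw [hrep g hg, hrep h hh]
  have hle : ∀ a ∈ Finset.univ, p a * loss (g a) (g a) ≤ p a * loss (h a) (g a) := fun a _ =>
    mul_le_mul_of_nonneg_left (by linarith [(kl_aux _ _ (hg1 a) (hh1 a)).1]) (hp a)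
  refine ⟨Finset.sum_le_sum hle, ?_⟩
  rintro ⟨a, ha⟩
  have : ∃ b, m b = m a ∧ 0 < p b := by
    by_contra! hcon
    refine absurd (hpos a) (not_lt.2 (Finset.sum_nonpos fun b _ => ?_))
    split_ifs with hb
    · exact hcon b hb
    · exact le_rfl
  obtain ⟨b, hb, hpb⟩ := this
  refine Finset.sum_lt_sum hle ⟨b, Finset.mem_univ _, ?_⟩
  refine mul_lt_mul_of_pos_left ?_ hpb
  have := (kl_aux _ _ (hg1 b) (hh1 b)).2 (by rwa [hg b a hb, hh b a hb])
  linarith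

lemma pr_prod {r s : ℕ} (P : (Fin s → Ans) × Fin r → ℝ) (E : (Fin s → Ans) × Fin r → Prop) :
    pr P E = ∑ α, ∑ j, if E (α, j) then P (α, j) else 0 := by
  unfold pr
  rw [Fintype.sum_prod_type]

lemma pr_and_eq {r s : ℕ} (P : (Fin s → Ans) × Fin r → ℝ) (E : (Fin s → Ans) → Prop)
    [DecidablePred E] (j : Fin r) :
    pr P (fun ω => E ω.1 ∧ ω.2 = j) = ∑ α, if E α then P (α, j) else 0 := by
  rw [pr_prod]
  refine Finset.sum_congr rfl fun α _ => ?_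
  by_cases h : E α <;> simp [h]

lemma pr_fst {r s : ℕ} (P : (Fin s → Ans) × Fin r → ℝ) (β : Fin s → Ans) :
    pr P (fun ω => ω.1 = β) = ∑ j, P (β, j) := by
  rw [pr_prod, Finset.sum_eq_single β]
  · exact Finset.sum_congr rfl fun j _ => if_pos rfl
  · intro γ _ hγ
    exact Finset.sum_eq_zero fun j _ => if_neg hγ
  · simp

/-- Consequence of blockwise conditional independence, in product form. -/
lemma indep_aux {r s b : ℕ} (P : (Fin s → Ans) × Fin r → ℝ)
    (hπ : ∀ j : Fin r, 0 < pr P (fun ω => ω.2 = j))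
    (B : Fin s → Fin b) (hA1 : Assump1 P B) (ℓ : Fin b) (α : Fin s → Ans) (j : Fin r)
    (E : (Fin s → Ans) → Prop) [DecidablePred E]
    (hE : ∀ β γ, (∀ m, B m = ℓ → β m = γ m) → (E β ↔ E γ)) :
    (∑ β, if E β ∧ (∀ m, B m ≠ ℓ → β m = α m) then P (β, j) else 0)
      = (∏ l ∈ Finset.univ.erase ℓ,
          cpr P (fun ω => ∀ m, B m = l → ω.1 m = α m) (fun ω => ω.2 = j))
        * ∑ γ, if E γ then P (γ, j) else 0 := by
  have hP : ∀ β, P (β, j) = pr P (fun ω => ω.2 = j) * ∏ l : Fin b,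
      cpr P (fun ω => ∀ m, B m = l → ω.1 m = β m) (fun ω => ω.2 = j) := by
    intro β
    rw [← hA1 j β]
    unfold cpr
    rw [mul_div_cancel₀ _ (hπ j).ne', pr_and_eq P (fun x => x = β) j,
      Finset.sum_eq_single β (fun γ _ hγ => if_neg hγ) (by simp), if_pos rfl]
  set R := ∏ l ∈ Finset.univ.erase ℓ,
          cpr P (fun ω => ∀ m, B m = l → ω.1 m = α m) (fun ω => ω.2 = j) with hR
  have hP2 : ∀ β, (∀ m, B m ≠ ℓ → β m = α m) →
      P (β, j) = R * ∑ γ, if (∀ m, B m = ℓ → γ m = β m) then P (γ, j) else 0 := by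
    intro β hβ
    rw [hP β, ← Finset.mul_prod_erase Finset.univ _ (Finset.mem_univ ℓ)]
    have : ∏ l ∈ Finset.univ.erase ℓ,
          cpr P (fun ω => ∀ m, B m = l → ω.1 m = β m) (fun ω => ω.2 = j) = R := by
      refine Finset.prod_congr rfl fun l hl => ?_
      congr 1
      funext ω
      refine propext (forall_congr' fun m => forall_congr' fun hm => ?_)
      rw [hβ m (by rw [hm]; exact (Finset.mem_erase.1 hl).1)]
    rw [this]
    unfold cpr
    rw [pr_and_eq P (fun x => ∀ m, B m = ℓ → x m = β m) j]
    have := (hπ j).ne'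
    field_simp
  calc _ = ∑ β, ∑ γ, if E β ∧ (∀ m, B m ≠ ℓ → β m = α m) then
            R * (if (∀ m, B m = ℓ → γ m = β m) then P (γ, j) else 0) else 0 := by
        refine Finset.sum_congr rfl fun β _ => ?_
        split_ifs with h
        · rw [hP2 β h.2, Finset.mul_sum]
        · simp
    _ = ∑ γ, ∑ β, if β = (fun m => if B m = ℓ then γ m else α m) then
            (if E γ then R * P (γ, j) else 0) else 0 := by
        rw [Finset.sum_comm]
        refine Finset.sum_congr rfl fun γ _ => Finset.sum_congr rfl fun β _ => ?_
        by_cases hβ : β = (fun m => if B m = ℓ then γ m else α m)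
        · have h1 : ∀ m, B m = ℓ → γ m = β m := by intro m hm; simp [hβ, hm]
          have h2 : ∀ m, B m ≠ ℓ → β m = α m := by intro m hm; simp [hβ, hm]
          have h3 := hE γ β h1
          rw [if_pos hβ, if_pos h1]
          by_cases h : E γ
          · rw [if_pos h, if_pos ⟨h3.1 h, h2⟩]
          · rw [if_neg h, if_neg (fun h' => h (h3.2 h'.1))]
        · rw [if_neg hβ]
          split_ifs with h1 h2
          · exfalso; apply hβ; funext m
            by_cases hm : B m = ℓ
            · simp [hm, h2 m hm]
            · simp [hm, h1.2 m hm]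
          · simp
          · rfl
    _ = _ := by
        rw [Finset.mul_sum]
        refine Finset.sum_congr rfl fun γ _ => ?_
        rw [Finset.sum_ite_eq']
        simp

lemma indep_cor {r s b : ℕ} (P : (Fin s → Ans) × Fin r → ℝ)
    (hπ : ∀ j : Fin r, 0 < pr P (fun ω => ω.2 = j))
    (B : Fin s → Fin b) (hA1 : Assump1 P B) (α : Fin s → Ans) (j : Fin r) (k : Fin s) :
    (∑ β, if β k = some true ∧ (∀ m, B m ≠ B k → β m = α m) then P (β, j) else 0)
      = trueQ P j k * pr P (fun ω => ω.2 = j ∧ maskEv B (B k) α ω) := by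
  have h0 := indep_aux P hπ B hA1 (B k) α j (fun β => β k = some true)
    (fun β γ h => by rw [h k rfl])
  refine h0.trans ?_
  have h1 := indep_aux P hπ B hA1 (B k) α j (fun _ => True) (fun _ _ _ => Iff.rfl)
  have h2 : pr P (fun ω => ω.2 = j ∧ maskEv B (B k) α ω)
      = ∑ β, if True ∧ (∀ m, B m ≠ B k → β m = α m) then P (β, j) else 0 := by
    rw [← pr_and_eq P (fun β => True ∧ (∀ m, B m ≠ B k → β m = α m)) j]
    congr 1
    funext ω
    simp [maskEv, and_comm]
  have h3 : pr P (fun ω => ω.2 = j) = ∑ β, if True then P (β, j) else 0 := by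
    rw [← pr_and_eq P (fun β => True) j]
    simp
  rw [h2, h1, ← h3]
  unfold trueQ cpr
  rw [pr_and_eq P (fun x => x k = some true) j]
  have := (hπ j).ne'
  field_simp

lemma mask_eq_iff {s b : ℕ} (B : Fin s → Fin b) (ℓ : Fin b) (α β : Fin s → Ans) :
    mask B ℓ β = mask B ℓ α ↔ ∀ m, B m ≠ ℓ → β m = α m := by
  unfold mask
  constructor
  · intro h m hm
    have := congrFun h m
    simpa [hm] using this
  · intro h
    funext m
    by_cases hm : B m = ℓ
    · simp [hm]
    · simp [hm, h m hm]

lemma Fk_mem {r s : ℕ} (k : Fin s) (v : Fin r → ℝ) (q : Fin r → Fin s → ℝ)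
    (hv : (∀ j, 0 ≤ v j) ∧ ∑ j, v j = 1) (hq : isProbbase q) :
    Fk k v q ∈ Set.Ioo (0:ℝ) 1 := by
  obtain ⟨h0, h1⟩ := hv
  have : ∃ j ∈ Finset.univ, v j ≠ 0 := by
    by_contra! h
    rw [Finset.sum_eq_zero h] at h1
    exact zero_ne_one h1
  obtain ⟨j, hj, hvj⟩ := this
  have hvj' := lt_of_le_of_ne (h0 j) hvj.symm
  unfold Fk
  constructor
  · exact Finset.sum_pos' (fun i _ => mul_nonneg (h0 i) (hq i k).1.le)
      ⟨j, hj, mul_pos hvj' (hq j k).1⟩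
  · rw [← h1]
    refine Finset.sum_lt_sum (fun i _ => ?_) ⟨j, hj, ?_⟩
    · exact mul_le_of_le_one_right (h0 i) (hq i k).2.le
    · exact mul_lt_of_lt_one_right hvj' (hq j k).2

lemma rank_inj {r : ℕ} {κ : Type*} [Fintype κ] (M : Matrix (Fin r) κ ℝ) (hM : M.rank = r)
    (u v : Fin r → ℝ) (h : ∀ k, ∑ j, u j * M j k = ∑ j, v j * M j k) : u = v := by
  have hli : LinearIndependent ℝ M.row := by
    rw [linearIndependent_iff_card_eq_finrank_span, Set.finrank, ← Matrix.rank_eq_finrank_span_row,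
      hM]
    simp
  refine Matrix.vecMul_injective_iff.2 hli ?_
  funext k
  exact h k

/-- Theorem 2 of the paper, identifiability. Under
Assumption 1, if all events `{A₋ℓ = α₋ℓ}` have positive probability, the VA
algorithm `V` is calibrated at a probbase (on answers outside a block) iff
that probbase agrees with the truth outside that block, and the candidate
probbase `qh` agrees with the true one on a block `ι` of size `≥ r` on which
the true probbase has full rank `r`, then `qh ≠ q` implies `I^V(qh) > I^V(q)`. -/
theorem statement1 {r s b : ℕ} (hr : 0 < r) (hs : 0 < s) (hb : 0 < b)
    (P : (Fin s → Ans) × Fin r → ℝ)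
    (hP0 : ∀ ω, 0 ≤ P ω) (hP1 : ∑ ω, P ω = 1)
    (hπ : ∀ j : Fin r, 0 < pr P (fun ω => ω.2 = j))
    (B : Fin s → Fin b) (hB : Function.Surjective B)
    (hA1 : Assump1 P B)
    (hq : isProbbase (trueQ P))
    (hpos : ∀ (ℓ : Fin b) (α : Fin s → Ans), 0 < pr P (maskEv B ℓ α))
    (V : (Fin s → Ans) → (Fin r → Fin s → ℝ) → Fin r → ℝ)
    (hV : isVA V)
    (hViff : ∀ (ℓ : Fin b) (qt : Fin r → Fin s → ℝ), isProbbase qt →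
      ((∀ (α : Fin s → Ans) (j : Fin r),
          V (mask B ℓ α) qt j = cpr P (fun ω => ω.2 = j) (maskEv B ℓ α))
        ↔ (∀ (j : Fin r) (k : Fin s), B k ≠ ℓ → qt j k = trueQ P j k)))
    (qh : Fin r → Fin s → ℝ) (hqh : isProbbase qh)
    (ι : Fin b)
    (hι : r ≤ (Finset.univ.filter (fun k : Fin s => B k = ι)).card)
    (hagree : ∀ (j : Fin r) (k : Fin s), B k = ι → qh j k = trueQ P j k)
    (hrank : (Matrix.of fun (j : Fin r) (k : {k : Fin s // B k = ι}) =>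
        trueQ P j k.1).rank = r)
    (hne : qh ≠ trueQ P) :
    impAcc P B V (trueQ P) < impAcc P B V qh := by
  have hps : ∀ (k : Fin s) (α : Fin s → Ans),
      (∑ β, if mask B (B k) β = mask B (B k) α then pr P (fun ω => ω.1 = β) else 0)
        = pr P (maskEv B (B k) α) := by
    intro k α
    rw [pr_prod]
    refine Finset.sum_congr rfl fun β _ => ?_
    have e := pr_fst P β
    rw [e]
    simp only [mask_eq_iff]
    by_cases h : ∀ m, B m ≠ B k → β m = α m
    · rw [if_pos h]
      refine Finset.sum_congr rfl fun j _ => ?_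
      rw [if_pos (show maskEv B (B k) α (β, j) from h)]
    · rw [if_neg h]
      symm
      refine Finset.sum_eq_zero fun j _ => ?_
      exact if_neg (show ¬ maskEv B (B k) α (β, j) from h)
  have hVq : ∀ (k : Fin s) (α : Fin s → Ans) (j : Fin r),
      V (mask B (B k) α) (trueQ P) j = cpr P (fun ω => ω.2 = j) (maskEv B (B k) α) :=
    fun k => (hViff (B k) (trueQ P) hq).2 fun _ _ _ => rfl
  have main := fun k : Fin s => gibbs_aux (mask B (B k)) (fun α => pr P (fun ω => ω.1 = α))
    (fun α => if α k = some true then (1:ℝ) else 0)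
    (fun α => Fk k (V (mask B (B k) α) (trueQ P)) (trueQ P))
    (fun α => Fk k (V (mask B (B k) α) qh) qh)
    (fun α => Finset.sum_nonneg fun ω _ => by split_ifs <;> simp [hP0])
    (fun a b h => by simp only [h]) (fun a b h => by simp only [h])
    (fun α => Fk_mem k _ _ (hV _ _ hq) hq) (fun α => Fk_mem k _ _ (hV _ _ hqh) hqh)
    (by
      intro α
      have hM := hpos (B k) α
      rw [hps k α]
      have e1 : Fk k (V (mask B (B k) α) (trueQ P)) (trueQ P) * pr P (maskEv B (B k) α)
          = ∑ j, trueQ P j k * pr P (fun ω => ω.2 = j ∧ maskEv B (B k) α ω) := by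
        unfold Fk
        rw [Finset.sum_mul]
        refine Finset.sum_congr rfl fun j _ => ?_
        rw [hVq k α j]
        unfold cpr
        have := hM.ne'
        field_simp
      rw [e1]
      have e2 : ∀ j, trueQ P j k * pr P (fun ω => ω.2 = j ∧ maskEv B (B k) α ω) =
          ∑ β, if β k = some true ∧ (∀ m, B m ≠ B k → β m = α m) then P (β, j) else 0 :=
        fun j => (indep_cor P hπ B hA1 α j k).symm
      rw [Finset.sum_congr rfl fun j _ => e2 j, Finset.sum_comm]
      refine Finset.sum_congr rfl fun β _ => ?_
      have e := pr_fst P β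
      rw [e]
      simp only [mask_eq_iff]
      by_cases h2 : ∀ m, B m ≠ B k → β m = α m
      · rw [if_pos h2]
        by_cases h1 : β k = some true
        · rw [if_pos h1, mul_one]
          exact Finset.sum_congr rfl fun j _ => (if_pos ⟨h1, h2⟩).symm
        · rw [if_neg h1, mul_zero]
          exact (Finset.sum_eq_zero fun j _ => if_neg fun h => h1 h.1).symm
      · rw [if_neg h2]
        exact (Finset.sum_eq_zero fun j _ => if_neg fun h => h2 h.2).symm)
    (fun α => by rw [hps k α]; exact hpos _ _)
  have hstrict : ∃ k : Fin s, ∃ α : Fin s → Ans,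
      Fk k (V (mask B (B k) α) (trueQ P)) (trueQ P) ≠ Fk k (V (mask B (B k) α) qh) qh := by
    by_contra! hcon
    have hVeq : ∀ (α : Fin s → Ans) (j : Fin r),
        V (mask B ι α) qh j = cpr P (fun ω => ω.2 = j) (maskEv B ι α) := by
      intro α j
      have hv : V (mask B ι α) qh = V (mask B ι α) (trueQ P) := by
        refine rank_inj _ hrank _ _ ?_
        rintro ⟨k, hk⟩
        have := hcon k α
        rw [hk] at this
        unfold Fk at this
        simp only [Matrix.of_apply]
        rw [this]
        exact Finset.sum_congr rfl fun j _ => by rw [hagree j k hk]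
      rw [hv]
      exact (hViff ι (trueQ P) hq).2 (fun _ _ _ => rfl) α j
    have hoff := (hViff ι qh hqh).1 hVeq
    apply hne
    funext j k
    by_cases hk : B k = ι
    · exact hagree j k hk
    · exact hoff j k hk
  obtain ⟨k, α, hkα⟩ := hstrict
  unfold impAcc
  refine mul_lt_mul_of_pos_left ?_ (by positivity)
  exact Finset.sum_lt_sum (fun k _ => (main k).1) ⟨k, Finset.mem_univ _, (main k).2 ⟨α, hkα⟩⟩
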